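/- Let h₁ = (y−z)²z − x³ − x²z and h₂ = x³ − 2xy² + 2xyz + y²z in ℂ[x,y,z]. Every homogeneous polynomial f of degree 12 in ℂ[x,y,z] satisfying all of the following conditions is the zero polynomial: (i) for every nonzero (a,b,c) ∈ ℂ³ with h₁(a,b,c) = h₂(a,b,c) = 0 that is not a scalar multiple of (0,1,0), every iterated partial derivative of f of total order < 3 vanishes at (a,b,c); (ii) every iterated partial derivative of f of total order < 2 vanishes at (0,1,0); (iii) every iterated partial derivative of f of total order < 5 vanishes at (4,9,6); (iv) every iterated partial derivative of f of total order < 6 vanishes at (0,1,1); (v) every iterated partial derivative of f of total order < 4 vanishes at (0,0,1). -/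

import Mathlib

open MvPolynomial

/-- `f` vanishes to order at least `m` at the point `p ∈ ℂ³`: every iterated partial
derivative of `f` of total order `< m` vanishes at `p`. -/
def VanishesToOrder (f : MvPolynomial (Fin 3) ℂ) (p : Fin 3 → ℂ) (m : ℕ) : Prop :=
  ∀ L : List (Fin 3), L.length < m →
    MvPolynomial.eval p (L.foldr (fun i g => MvPolynomial.pderiv i g) f) = 0

/-- The nodal cubic `h₁ = (y-z)²z - x³ - x²z`. -/
noncomputable def h₁ : MvPolynomial (Fin 3) ℂ :=
  (X 1 - X 2) ^ 2 * X 2 - X 0 ^ 3 - X 0 ^ 2 * X 2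

/-- The nodal cubic `h₂ = x³ - 2xy² + 2xyz + y²z`. -/
noncomputable def h₂ : MvPolynomial (Fin 3) ℂ :=
  X 0 ^ 3 - 2 * X 0 * X 1 ^ 2 + 2 * X 0 * X 1 * X 2 + X 1 ^ 2 * X 2

namespace VanishesToOrder

variable {f g : MvPolynomial (Fin 3) ℂ} {p : Fin 3 → ℂ} {m n : ℕ}

lemma zero_right (f : MvPolynomial (Fin 3) ℂ) (p : Fin 3 → ℂ) : VanishesToOrder f p 0 :=
  fun _ hL => absurd hL (Nat.not_lt_zero _)

lemma succ_iff :
    VanishesToOrder f p (m + 1) ↔ eval p f = 0 ∧ ∀ i, VanishesToOrder (pderiv i f) p m := by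
  constructor
  · intro h
    refine ⟨h [] (by simp), fun i L hL => ?_⟩
    have := h (L ++ [i]) (by simpa using hL)
    simpa [List.foldr_append] using this
  · rintro ⟨h0, h1⟩ L hL
    rcases List.eq_nil_or_concat L with rfl | ⟨L, i, rfl⟩
    · simpa using h0
    · have := h1 i L (by simpa using hL)
      simpa [List.foldr_append] using this

lemma mono (h : VanishesToOrder f p n) (hmn : m ≤ n) : VanishesToOrder f p m :=
  fun L hL => h L (hL.trans_le hmn)

lemma pderiv (h : VanishesToOrder f p (m + 1)) (i : Fin 3) :
    VanishesToOrder (MvPolynomial.pderiv i f) p m :=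
  (succ_iff.1 h).2 i

lemma eval_eq_zero (h : VanishesToOrder f p m) (hm : 0 < m) : eval p f = 0 :=
  h [] hm

lemma add (hf : VanishesToOrder f p m) (hg : VanishesToOrder g p m) :
    VanishesToOrder (f + g) p m := by
  induction m generalizing f g with
  | zero => exact zero_right _ _
  | succ m ih =>
    rw [succ_iff] at *
    refine ⟨by simp [hf.1, hg.1], fun i => ?_⟩
    rw [map_add]
    exact ih (hf.2 i) (hg.2 i)

lemma zero (p : Fin 3 → ℂ) (m : ℕ) : VanishesToOrder 0 p m := by
  induction m with
  | zero => exact zero_right _ _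
  | succ m ih => exact succ_iff.2 ⟨by simp, fun i => by rwa [map_zero]⟩

lemma mul_left (h : MvPolynomial (Fin 3) ℂ) (hf : VanishesToOrder f p m) :
    VanishesToOrder (h * f) p m := by
  induction m generalizing f h with
  | zero => exact zero_right _ _
  | succ m ih =>
    refine succ_iff.2 ⟨by simp [hf.eval_eq_zero], fun i => ?_⟩
    rw [pderiv_mul]
    exact add (ih _ (hf.mono m.le_succ)) (ih _ (hf.pderiv i))

lemma neg (hf : VanishesToOrder f p m) : VanishesToOrder (-f) p m := by
  simpa using hf.mul_left (-1)

lemma sum {ι : Type*} (s : Finset ι) (F : ι → MvPolynomial (Fin 3) ℂ)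
    (h : ∀ i ∈ s, VanishesToOrder (F i) p m) : VanishesToOrder (∑ i ∈ s, F i) p m := by
  classical
  induction s using Finset.induction_on with
  | empty => simpa using zero p m
  | insert a s ha ih =>
    rw [Finset.sum_insert ha]
    exact add (h a (by simp)) (ih fun i hi => h i (by simp [hi]))

/-- A factor that does not vanish at `p` does not contribute to the order at `p`. -/
lemma of_mul_left {h : MvPolynomial (Fin 3) ℂ} (hp : eval p h ≠ 0)
    (hf : VanishesToOrder (h * f) p m) : VanishesToOrder f p m := by
  induction m generalizing f with
  | zero => exact zero_right _ _
  | succ m ih =>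
    have hfm : VanishesToOrder f p m := ih (hf.mono m.le_succ)
    refine succ_iff.2 ⟨?_, fun i => ih ?_⟩
    · simpa [hp] using hf.eval_eq_zero m.succ_pos
    · have h1 := hf.pderiv i
      rw [pderiv_mul] at h1
      simpa using h1.add (hfm.mul_left (MvPolynomial.pderiv i h)).neg

end VanishesToOrder

lemma derivation_aeval {B : Type*} [CommRing B] [Algebra ℂ B] (D : Derivation ℂ B B)
    (γ : Fin 3 → B) (f : MvPolynomial (Fin 3) ℂ) :
    D (aeval γ f) = ∑ i, aeval γ (pderiv i f) * D (γ i) := by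
  induction f using MvPolynomial.induction_on with
  | C a => simp
  | add p q hp hq => simp [hp, hq, add_mul, Finset.sum_add_distrib]
  | mul_X p j hp =>
    simp only [map_mul, aeval_X, Derivation.leibniz, hp, smul_eq_mul, pderiv_X, map_add, add_mul,
      Finset.sum_add_distrib, Finset.mul_sum, Pi.single_apply]
    congr 1
    · simp [apply_ite, ite_mul]
    · exact Finset.sum_congr rfl fun i _ => by ring

lemma eval_aeval_polynomial (γ : Fin 3 → Polynomial ℂ) (f : MvPolynomial (Fin 3) ℂ) (t : ℂ) :
    (aeval γ f).eval t = eval (fun i => (γ i).eval t) f := by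
  simp only [← Polynomial.coe_aeval_eq_eval, ← aeval_eq_eval]
  exact comp_aeval_apply γ (Polynomial.aeval t) f

/-- A polynomial vanishing to order `m` at a point of a parametrised curve restricts to a
polynomial with a zero of order at least `m`. -/
lemma VanishesToOrder.pow_dvd_aeval {f : MvPolynomial (Fin 3) ℂ} {m : ℕ}
    {γ : Fin 3 → Polynomial ℂ} {t : ℂ} (h : VanishesToOrder f (fun i => (γ i).eval t) m) :
    (Polynomial.X - Polynomial.C t) ^ m ∣ aeval γ f := by
  induction m generalizing f with
  | zero => simp
  | succ m ih =>
    by_cases h0 : aeval γ f = 0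
    · simp [h0]
    have heval : (aeval γ f).IsRoot t := by
      have := h.eval_eq_zero m.succ_pos
      rw [Polynomial.IsRoot, eval_aeval_polynomial, this]
    have hd : (Polynomial.X - Polynomial.C t) ^ m ∣ Polynomial.derivative (aeval γ f) := by
      have := derivation_aeval Polynomial.derivative' γ f
      rw [Polynomial.derivative'_apply] at this
      rw [this]
      exact Finset.dvd_sum fun i _ => Dvd.dvd.mul_right (ih (h.pderiv i)) _
    rw [← Polynomial.le_rootMultiplicity_iff h0]
    have h1 := Polynomial.derivative_rootMultiplicity_of_root heval
    have h2 : 0 < (aeval γ f).rootMultiplicity t := (Polynomial.rootMultiplicity_pos h0).2 heval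
    by_cases hd0 : Polynomial.derivative (aeval γ f) = 0
    · exfalso
      obtain ⟨c, hc⟩ := Polynomial.natDegree_eq_zero.1
        (Polynomial.derivative_eq_zero.1 hd0)
      rw [← hc] at heval h0
      apply h0
      simpa using heval
    · have := (Polynomial.le_rootMultiplicity_iff hd0).2 hd
      omega

lemma VanishesToOrder.comp {f : MvPolynomial (Fin 3) ℂ} {m : ℕ} {p : Fin 3 → ℂ}
    {T : Fin 3 → MvPolynomial (Fin 3) ℂ} (h : VanishesToOrder f (fun i => eval p (T i)) m) :
    VanishesToOrder (aeval T f) p m := by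
  induction m generalizing f with
  | zero => exact .zero_right _ _
  | succ m ih =>
    refine succ_iff.2 ⟨?_, fun i => ?_⟩
    · have := h.eval_eq_zero m.succ_pos
      rw [← aeval_eq_eval, comp_aeval_apply]
      rwa [← aeval_eq_eval] at this
    · rw [derivation_aeval]
      refine sum _ _ fun j _ => ?_
      rw [mul_comm]
      exact mul_left _ (ih (h.pderiv j))

/-- Vanishing to order `m` at a coordinate point kills every coefficient of a homogeneous
polynomial whose degree in the other variables is less than `m`. -/
lemma VanishesToOrder.coeff_eq_zero {f : MvPolynomial (Fin 3) ℂ} {n m : ℕ} {j : Fin 3}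
    (hf : f.IsHomogeneous n) (h : VanishesToOrder f (Pi.single j 1) m) {d : Fin 3 →₀ ℕ}
    (hd : n < d j + m) : coeff d f = 0 := by
  by_cases hdn : d.degree = n
  swap
  · exact hf.coeff_eq_zero hdn
  induction m generalizing f n d with
  | zero =>
    have := Finsupp.le_degree j d
    omega
  | succ m ih =>
    by_cases hi : ∃ i, i ≠ j ∧ d i ≠ 0
    · obtain ⟨i, hij, hi⟩ := hi
      obtain ⟨e, rfl⟩ : ∃ e, d = e + Finsupp.single i 1 := by
        refine ⟨d - Finsupp.single i 1, (tsub_add_cancel_of_le ?_).symm⟩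
        simpa [Nat.one_le_iff_ne_zero] using hi
      have hdeg : e.degree + 1 = n := by simpa using hdn
      have := ih (f := MvPolynomial.pderiv i f) (n := n - 1) (d := e) hf.pderiv (h.pderiv i)
        (by simp [hij] at hd; omega) (by omega)
      rw [coeff_pderiv] at this
      rcases mul_eq_zero.1 this with h | h
      · exact h
      · exfalso; norm_cast at h
    · push Not at hi
      have hds : d = Finsupp.single j n := by
        have : d = Finsupp.single j (d j) := by
          ext i
          by_cases hij : i = j
          · simp [hij]
          · simp [hi i hij, Ne.symm hij]
        rw [this, Finsupp.degree_single] at hdn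
        rwa [hdn] at this
      have h0 := h.eval_eq_zero m.succ_pos
      rw [eval_eq', Finset.sum_eq_single d] at h0
      · rw [Finset.prod_eq_one, mul_one] at h0
        · exact h0
        · intro i _
          by_cases hij : i = j
          · simp [hij]
          · simp [hi i hij]
      · intro b hb hbd
        have hbn : b.degree = n := hf.degree_eq_sum_deg_support hb |>.symm
        obtain ⟨i, hij, hbi⟩ : ∃ i, i ≠ j ∧ b i ≠ 0 := by
          by_contra! hb0
          have hb1 : b = Finsupp.single j (b j) := by
            ext i
            by_cases hij : i = j
            · simp [hij]
            · simp [hb0 i hij, Ne.symm hij]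
          rw [hb1, Finsupp.degree_single] at hbn
          rw [hbn] at hb1
          exact hbd (hb1.trans hds.symm)
        rw [Finset.prod_eq_zero (Finset.mem_univ i), mul_zero]
        simp [hij, hbi]
      · intro hd
        simp [notMem_support_iff.1 hd]

namespace MvPolynomial.IsHomogeneous

variable {f : MvPolynomial (Fin 3) ℂ} {n d : ℕ}

lemma eval_smul_apply (hf : f.IsHomogeneous n) (s : ℂ) (p : Fin 3 → ℂ) :
    eval (fun i => s * p i) f = s ^ n * eval p f := by
  rw [eval_eq', eval_eq', Finset.mul_sum]
  refine Finset.sum_congr rfl fun e he => ?_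
  simp only [mul_pow, Finset.prod_mul_distrib]
  rw [Finset.prod_pow_eq_pow_sum, ← Finsupp.degree_eq_sum,
    show n = e.degree from hf.degree_eq_sum_deg_support he]
  ring

/-- Restriction of a form of degree `n` to a curve parametrised by polynomials of degree at most
`d`: a bound on the degree, and the value at infinity. -/
lemma natDegree_aeval_le_and_coeff (hf : f.IsHomogeneous n) {γ : Fin 3 → Polynomial ℂ}
    (hγ : ∀ i, (γ i).natDegree ≤ d) :
    (MvPolynomial.aeval γ f).natDegree ≤ n * d ∧
      (MvPolynomial.aeval γ f).coeff (n * d) = eval (fun i => (γ i).coeff d) f := by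
  have hpow (i : Fin 3) (k : ℕ) : (γ i ^ k).natDegree ≤ k * d :=
    Polynomial.natDegree_pow_le_of_le k (hγ i)
  have key (e : Fin 3 →₀ ℕ) (he : e ∈ f.support) :
      (∏ i, γ i ^ e i).natDegree ≤ n * d ∧
        (∏ i, γ i ^ e i).coeff (n * d) = ∏ i, (γ i).coeff d ^ e i := by
    have hn : n * d = e 0 * d + e 1 * d + e 2 * d := by
      rw [show n = e.degree from hf.degree_eq_sum_deg_support he, Finsupp.degree_eq_sum,
        Fin.sum_univ_three]
      ring
    have h01 := Polynomial.natDegree_mul_le_of_le (hpow 0 (e 0)) (hpow 1 (e 1))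
    rw [hn, Fin.prod_univ_three, Fin.prod_univ_three]
    refine ⟨Polynomial.natDegree_mul_le_of_le h01 (hpow 2 (e 2)), ?_⟩
    rw [Polynomial.coeff_mul_add_eq_of_natDegree_le h01 (hpow 2 (e 2)),
      Polynomial.coeff_mul_add_eq_of_natDegree_le (hpow 0 (e 0)) (hpow 1 (e 1)),
      mul_comm (e 0), mul_comm (e 1), mul_comm (e 2)]
    simp only [mul_comm d, Polynomial.coeff_pow_of_natDegree_le (hγ _)]
  rw [aeval_def, eval₂_eq', eval_eq']
  constructor
  · refine Polynomial.natDegree_sum_le_of_forall_le _ _ fun e he => ?_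
    exact (Polynomial.natDegree_C_mul_le _ _).trans (key e he).1
  · rw [Polynomial.finsetSum_coeff]
    refine Finset.sum_congr rfl fun e he => ?_
    rw [Polynomial.algebraMap_eq, Polynomial.coeff_C_mul, (key e he).2]

lemma exists_eq_mul_of_mul {h g : MvPolynomial (Fin 3) ℂ} (hh : h.IsHomogeneous d)
    (hf : f.IsHomogeneous (n + d)) (hfg : f = h * g) :
    ∃ g' : MvPolynomial (Fin 3) ℂ, g'.IsHomogeneous n ∧ f = h * g' := by
  refine ⟨homogeneousComponent n g, homogeneousComponent_isHomogeneous n g, ?_⟩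
  have hcomp (i : ℕ) : homogeneousComponent (n + d) (h * homogeneousComponent i g) =
      if i = n then h * homogeneousComponent i g else 0 := by
    have := homogeneousComponent_of_mem (m := n + d)
      ((mem_homogeneousSubmodule _ _).2 (hh.mul (homogeneousComponent_isHomogeneous i g)))
    rw [this]
    exact if_congr (by omega) rfl rfl
  rw [← homogeneousComponent_eq_self hf, hfg]
  conv_lhs => rw [← sum_homogeneousComponent g, Finset.mul_sum, map_sum]
  simp only [hcomp, Finset.sum_ite_eq', Finset.mem_range]
  split_ifs with hn
  · rfl
  · rw [homogeneousComponent_eq_zero _ _ (by omega), mul_zero]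

end MvPolynomial.IsHomogeneous

/-- The rational parametrisation `t ↦ (t² - 1, 1 + t(t² - 1), 1)` of the cubic `h₁ = 0`. -/
noncomputable def nodalCurve : Fin 3 → Polynomial ℂ :=
  ![Polynomial.X ^ 2 - 1, 1 + Polynomial.X * (Polynomial.X ^ 2 - 1), 1]

lemma eval_nodalCurve (t : ℂ) :
    (fun i => (nodalCurve i).eval t) = ![t ^ 2 - 1, 1 + t * (t ^ 2 - 1), 1] := by
  ext i
  fin_cases i <;> simp [nodalCurve]

lemma natDegree_nodalCurve_le (i : Fin 3) : (nodalCurve i).natDegree ≤ 3 := by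
  fin_cases i
  · change (Polynomial.X ^ 2 - 1 : Polynomial ℂ).natDegree ≤ 3
    compute_degree!
  · change (1 + Polynomial.X * (Polynomial.X ^ 2 - 1) : Polynomial ℂ).natDegree ≤ 3
    compute_degree!
  · simp [nodalCurve]

lemma coeff_nodalCurve : (fun i => (nodalCurve i).coeff 3) = ![0, 1, 0] := by
  ext i
  fin_cases i <;> simp [nodalCurve, Polynomial.coeff_one,
    Polynomial.coeff_X_pow]

lemma isHomogeneous_h₁ : h₁.IsHomogeneous 3 := by
  have hX (i : Fin 3) : (X i : MvPolynomial (Fin 3) ℂ).IsHomogeneous 1 := isHomogeneous_X _ _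
  exact (((((hX 1).sub (hX 2)).pow 2).mul (hX 2)).sub ((hX 0).pow 3)).sub
    (((hX 0).pow 2).mul (hX 2))

lemma aeval_nodalCurve_h₁ : aeval nodalCurve h₁ = 0 := by
  simp [h₁, nodalCurve]
  ring

lemma exists_eq_h₁_mul_add (f : MvPolynomial (Fin 3) ℂ) :
    ∃ (g : MvPolynomial (Fin 3) ℂ) (a b c : MvPolynomial (Fin 2) ℂ),
      f = h₁ * g + rename Fin.succ a + X 0 * rename Fin.succ b + X 0 ^ 2 * rename Fin.succ c := by
  induction f using MvPolynomial.induction_on with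
  | C r => exact ⟨0, C r, 0, 0, by simp⟩
  | add p q hp hq =>
    obtain ⟨g, a, b, c, rfl⟩ := hp
    obtain ⟨g', a', b', c', rfl⟩ := hq
    refine ⟨g + g', a + a', b + b', c + c', ?_⟩
    simp only [map_add]
    ring
  | mul_X p i hp =>
    obtain ⟨g, a, b, c, rfl⟩ := hp
    refine Fin.cases ?_ (fun j => ?_) i
    · refine ⟨g * X 0 - rename Fin.succ c, c * ((X 0 - X 1) ^ 2 * X 1), a, b - c * X 1, ?_⟩
      simp only [map_mul, map_sub, map_pow, rename_X, h₁, Fin.succ_zero_eq_one,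
        Fin.succ_one_eq_two]
      ring
    · refine ⟨g * X j.succ, a * X j, b * X j, c * X j, ?_⟩
      simp only [map_mul, rename_X]
      ring

open Polynomial in
lemma eq_zero_of_comp_add_comp_add_comp {a b c x y : Polynomial ℂ} (hx : x.natDegree = 2)
    (hy : y.natDegree = 3) (h : a.comp y + x * b.comp y + x ^ 2 * c.comp y = 0) :
    a = 0 ∧ b = 0 ∧ c = 0 := by
  have hx0 : x ≠ 0 := by rintro rfl; simp at hx
  have hcomp (q : Polynomial ℂ) : q.comp y = 0 ↔ q = 0 := by
    constructor
    · intro hq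
      rcases Polynomial.comp_eq_zero_iff.1 hq with h | h
      · exact h
      · rw [h.2] at hy; simp at hy
    · rintro rfl; simp
  let F : Fin 3 → Polynomial ℂ := ![a.comp y, x * b.comp y, x ^ 2 * c.comp y]
  have hdeg (i : Fin 3) (hi : F i ≠ 0) : ∃ k, (F i).natDegree = 2 * (i : ℕ) + 3 * k := by
    fin_cases i
    · exact ⟨a.natDegree, by simp [F, natDegree_comp, hy, mul_comm]⟩
    · refine ⟨b.natDegree, ?_⟩
      have hb : b.comp y ≠ 0 := right_ne_zero_of_mul hi
      simp [F, natDegree_mul hx0 hb, natDegree_comp, hy, hx, mul_comm]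
    · refine ⟨c.natDegree, ?_⟩
      have hc : c.comp y ≠ 0 := right_ne_zero_of_mul hi
      simp [F, natDegree_mul (pow_ne_zero 2 hx0) hc, natDegree_comp, hy, hx, mul_comm]
  have hsum : ∑ i, F i = 0 := by simpa [F, Fin.sum_univ_three] using h
  have hF := degree_sum_eq_of_disjoint F Finset.univ (by
    intro i hi j hj hij hd
    obtain ⟨k, hk⟩ := hdeg i hi.2
    obtain ⟨l, hl⟩ := hdeg j hj.2
    have := natDegree_eq_of_degree_eq hd
    rw [hk, hl] at this
    apply hij
    ext
    omega)
  rw [hsum, degree_zero, eq_comm, Finset.sup_eq_bot_iff] at hF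
  have hF0 (i : Fin 3) : F i = 0 := degree_eq_bot.1 (hF i (Finset.mem_univ i))
  have h0 := hF0 0
  have h1 := hF0 1
  have h2 := hF0 2
  simp only [F, Matrix.cons_val] at h0 h1 h2
  exact ⟨(hcomp a).1 h0, (hcomp b).1 ((mul_eq_zero.1 h1).resolve_left hx0),
    (hcomp c).1 ((mul_eq_zero.1 h2).resolve_left (pow_ne_zero 2 hx0))⟩

lemma eq_zero_of_aeval_lines {a : MvPolynomial (Fin 2) ℂ}
    (h : ∀ s : ℂ, s ≠ 0 →
      aeval ![Polynomial.C s * Polynomial.X, Polynomial.C s] a = (0 : Polynomial ℂ)) :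
    a = 0 := by
  have hX : (X 1 : MvPolynomial (Fin 2) ℂ) * a = 0 := by
    refine MvPolynomial.funext fun p => ?_
    by_cases hp : p 1 = 0
    · simp [hp]
    have := congrArg (Polynomial.aeval (p 0 / p 1)) (h (p 1) hp)
    rw [comp_aeval_apply] at this
    have hpt : (fun i => (Polynomial.aeval (p 0 / p 1)) ((![Polynomial.C (p 1) * Polynomial.X,
        Polynomial.C (p 1)] : Fin 2 → Polynomial ℂ) i)) = p := by
      ext i
      fin_cases i
      · simp [mul_div_cancel₀ _ hp]
      · simp
    rw [hpt, aeval_eq_eval] at this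
    simp [this]
  exact (mul_eq_zero.1 hX).resolve_left (X_ne_zero 1)

/-- A form that vanishes identically on the nodal cubic is divisible by its equation. -/
lemma exists_eq_h₁_mul_of_aeval_eq_zero {f : MvPolynomial (Fin 3) ℂ} {n : ℕ}
    (hf : f.IsHomogeneous (n + 3)) (h : aeval nodalCurve f = 0) :
    ∃ g : MvPolynomial (Fin 3) ℂ, g.IsHomogeneous n ∧ f = h₁ * g := by
  obtain ⟨g, a, b, c, hdiv⟩ := exists_eq_h₁_mul_add f
  have hline (s : ℂ) (hs : s ≠ 0) :
      aeval ![Polynomial.C s * Polynomial.X, Polynomial.C s] a = (0 : Polynomial ℂ) ∧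
      aeval ![Polynomial.C s * Polynomial.X, Polynomial.C s] b = (0 : Polynomial ℂ) ∧
      aeval ![Polynomial.C s * Polynomial.X, Polynomial.C s] c = (0 : Polynomial ℂ) := by
    have hev (q : MvPolynomial (Fin 2) ℂ) (t : ℂ) :
        ((aeval ![Polynomial.C s * Polynomial.X, Polynomial.C s] q : Polynomial ℂ).comp
          (1 + Polynomial.X * (Polynomial.X ^ 2 - 1))).eval t =
        eval ![s * (t ^ 2 - 1), s * (1 + t * (t ^ 2 - 1)), s] (rename Fin.succ q) := by
      rw [Polynomial.eval_comp, ← Polynomial.coe_aeval_eq_eval, comp_aeval_apply, eval_rename,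
        ← aeval_eq_eval]
      congr 2
      ext i
      fin_cases i <;> simp
    refine eq_zero_of_comp_add_comp_add_comp (x := Polynomial.C s * (Polynomial.X ^ 2 - 1))
      (y := 1 + Polynomial.X * (Polynomial.X ^ 2 - 1)) ?_ ?_ ?_
    · rw [Polynomial.natDegree_C_mul hs]
      compute_degree!
    · compute_degree!
    · refine Polynomial.funext fun t => ?_
      have h1 := hf.eval_smul_apply s (fun i => (nodalCurve i).eval t)
      have h2 := isHomogeneous_h₁.eval_smul_apply s (fun i => (nodalCurve i).eval t)
      rw [← eval_aeval_polynomial, h, Polynomial.eval_zero, mul_zero] at h1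
      rw [← eval_aeval_polynomial, aeval_nodalCurve_h₁, Polynomial.eval_zero, mul_zero] at h2
      have hpt : (fun i => s * (nodalCurve i).eval t) =
          ![s * (t ^ 2 - 1), s * (1 + t * (t ^ 2 - 1)), s] := by
        ext i
        have := congrFun (eval_nodalCurve t) i
        rw [this]
        fin_cases i <;> simp
      rw [hpt] at h1 h2
      rw [hdiv] at h1
      simp only [map_add, map_mul, map_pow, h2, eval_X] at h1
      simp only [Polynomial.eval_add, Polynomial.eval_mul, Polynomial.eval_pow, hev]
      simpa using h1
  have ha := eq_zero_of_aeval_lines fun s hs => (hline s hs).1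
  have hb := eq_zero_of_aeval_lines fun s hs => (hline s hs).2.1
  have hc := eq_zero_of_aeval_lines fun s hs => (hline s hs).2.2
  exact isHomogeneous_h₁.exists_eq_mul_of_mul hf (g := g) (by simpa [ha, hb, hc] using hdiv)

/-- The parameters on `h₁ = 0` of its intersection points with `h₂ = 0` other than `(0, 1, 0)`
are the roots of this polynomial. -/
noncomputable def basePoly : Polynomial ℂ :=
  -2 * Polynomial.X ^ 8 + 8 * Polynomial.X ^ 6 - 2 * Polynomial.X ^ 5 - 11 * Polynomial.X ^ 4 +
  6 * Polynomial.X ^ 3 + 6 * Polynomial.X ^ 2 - 4 * Polynomial.X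

/-- The restriction to the curve `h₁ = 0` of the linear form `4y - 9x`, the equation of the line
through `(4, 9, 6)` and `(0, 0, 1)`. -/
noncomputable def lineCubic : Polynomial ℂ :=
  4 * Polynomial.X ^ 3 - 9 * Polynomial.X ^ 2 - 4 * Polynomial.X + 13

lemma isCoprime_of_mul_add_mul_eq_natCast {p q a b : Polynomial ℂ} {N : ℕ} (hN : N ≠ 0)
    (h : a * p + b * q = (N : Polynomial ℂ)) : IsCoprime p q := by
  have hC : Polynomial.C ((N : ℂ)⁻¹) * (N : Polynomial ℂ) = 1 := by
    rw [← Polynomial.C_eq_natCast, ← Polynomial.C_mul, inv_mul_cancel₀ (Nat.cast_ne_zero.2 hN),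
      Polynomial.C_1]
  exact ⟨Polynomial.C ((N : ℂ)⁻¹) * a, Polynomial.C ((N : ℂ)⁻¹) * b, by
    rw [← hC, ← h]; ring⟩

lemma derivative_basePoly : Polynomial.derivative basePoly =
    -16 * Polynomial.X ^ 7 + 48 * Polynomial.X ^ 5 - 10 * Polynomial.X ^ 4 -
    44 * Polynomial.X ^ 3 + 18 * Polynomial.X ^ 2 + 12 * Polynomial.X - 4 := by
  simp only [basePoly, Polynomial.derivative_add, Polynomial.derivative_sub,
    Polynomial.derivative_mul, Polynomial.derivative_X_pow, Polynomial.derivative_X,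
    Polynomial.derivative_ofNat, Polynomial.derivative_neg, map_ofNat, Nat.cast_ofNat]
  ring

lemma separable_basePoly : basePoly.Separable :=
  isCoprime_of_mul_add_mul_eq_natCast (N := 52528) (by norm_num)
    (a := 190448 * Polynomial.X ^ 6 + 135264 * Polynomial.X ^ 5 - 504048 * Polynomial.X ^ 4 -
      224554 * Polynomial.X ^ 3 + 448688 * Polynomial.X ^ 2 - 2202 * Polynomial.X - 118744)
    (b := -23806 * Polynomial.X ^ 7 - 16908 * Polynomial.X ^ 6 + 86812 * Polynomial.X ^ 5 +
      36050 * Polynomial.X ^ 4 - 119481 * Polynomial.X ^ 3 + 3036 * Polynomial.X ^ 2 +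
      79348 * Polynomial.X - 13132)
    (by rw [derivative_basePoly, basePoly]; push_cast; ring)

lemma isCoprime_basePoly_X_sq_sub_one : IsCoprime basePoly (Polynomial.X ^ 2 - 1 : Polynomial ℂ) :=
  isCoprime_of_mul_add_mul_eq_natCast (N := 1) (by norm_num)
    (a := 1)
    (b := 2 * Polynomial.X ^ 6 - 6 * Polynomial.X ^ 4 + 2 * Polynomial.X ^ 3 + 5 * Polynomial.X ^ 2
      - 4 * Polynomial.X - 1)
    (by rw [basePoly]; push_cast; ring)

lemma isCoprime_basePoly_three_mul_X_sq_sub_one :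
    IsCoprime basePoly (3 * Polynomial.X ^ 2 - 1 : Polynomial ℂ) :=
  isCoprime_of_mul_add_mul_eq_natCast (N := 715) (by norm_num)
    (a := -2916 * Polynomial.X - 1377)
    (b := -1944 * Polynomial.X ^ 7 - 918 * Polynomial.X ^ 6 + 7128 * Polynomial.X ^ 5 +
      1422 * Polynomial.X ^ 4 - 9234 * Polynomial.X ^ 3 + 1257 * Polynomial.X ^ 2 +
      5508 * Polynomial.X - 715)
    (by rw [basePoly]; push_cast; ring)

lemma isCoprime_basePoly_lineCubic : IsCoprime basePoly lineCubic :=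
  isCoprime_of_mul_add_mul_eq_natCast (N := 10088351) (by norm_num)
    (a := 3658608 * Polynomial.X ^ 2 - 8238680 * Polynomial.X + 2743775)
    (b := 1829304 * Polynomial.X ^ 7 - 3406 * Polynomial.X ^ 6 - 4123688 * Polynomial.X ^ 5 +
      3079722 * Polynomial.X ^ 4 + 3271038 * Polynomial.X ^ 3 - 2930851 * Polynomial.X ^ 2 +
      1083016 * Polynomial.X + 776027)
    (by rw [basePoly, lineCubic]; push_cast; ring)

lemma isCoprime_X_sq_sub_one_three_mul_X_sq_sub_one :
    IsCoprime (Polynomial.X ^ 2 - 1 : Polynomial ℂ) (3 * Polynomial.X ^ 2 - 1 : Polynomial ℂ) :=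
  isCoprime_of_mul_add_mul_eq_natCast (N := 2) (by norm_num)
    (a := -3)
    (b := 1)
    (by push_cast; ring)

lemma isCoprime_X_sq_sub_one_lineCubic : IsCoprime (Polynomial.X ^ 2 - 1 : Polynomial ℂ) lineCubic :=
  isCoprime_of_mul_add_mul_eq_natCast (N := 4) (by norm_num)
    (a := -4 * Polynomial.X + 9)
    (b := 1)
    (by rw [lineCubic]; push_cast; ring)

lemma natDegree_lineCubic : lineCubic.natDegree = 3 := by
  rw [lineCubic]
  compute_degree!

lemma natDegree_basePoly : basePoly.natDegree = 8 := by
  rw [basePoly]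
  compute_degree!

lemma coeff_eq_zero_of_lineCubic_sq_dvd {e₀ e₁ e₂ e₃ e₄ e₅ : ℂ}
    (h : lineCubic ^ 2 ∣ Polynomial.C e₀ + Polynomial.C e₁ * Polynomial.X +
      Polynomial.C e₂ * Polynomial.X ^ 2 + Polynomial.C e₃ * Polynomial.X ^ 3 +
      Polynomial.C e₄ * Polynomial.X ^ 4 + Polynomial.C e₅ * Polynomial.X ^ 5) :
    e₀ = 0 ∧ e₁ = 0 ∧ e₂ = 0 ∧ e₃ = 0 ∧ e₄ = 0 ∧ e₅ = 0 := by
  have h0 := Polynomial.eq_zero_of_dvd_of_natDegree_lt h (by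
    rw [Polynomial.natDegree_pow, natDegree_lineCubic]
    refine Nat.lt_of_le_of_lt (m := 5) ?_ (by norm_num)
    compute_degree!)
  have hc (k : ℕ) := congrArg (Polynomial.coeff · k) h0
  refine ⟨?_, ?_, ?_, ?_, ?_, ?_⟩
  · simpa [Polynomial.coeff_X, Polynomial.coeff_C] using hc 0
  · simpa [Polynomial.coeff_X, Polynomial.coeff_C] using hc 1
  · simpa [Polynomial.coeff_X, Polynomial.coeff_C] using hc 2
  · simpa [Polynomial.coeff_X, Polynomial.coeff_C] using hc 3
  · simpa [Polynomial.coeff_X, Polynomial.coeff_C] using hc 4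
  · simpa [Polynomial.coeff_X, Polynomial.coeff_C] using hc 5

set_option maxHeartbeats 2000000 in
lemma eq_zero_of_lineCubic_sq_dvd {q₀ q₁ q₂ a₀ a₁ a₂ : ℂ}
    (h : lineCubic ^ 2 ∣ basePoly ^ 2 * (Polynomial.X ^ 2 - 1) ^ 4 *
        (Polynomial.C q₀ + Polynomial.C q₁ * Polynomial.X + Polynomial.C q₂ * Polynomial.X ^ 2) +
      (Polynomial.C a₀ * ((Polynomial.X ^ 2 - 1) ^ 4 * (5 - 3 * Polynomial.X ^ 2) ^ 5) +
        lineCubic * (Polynomial.C a₁ * ((Polynomial.X ^ 2 - 1) ^ 4 *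
            (5 - 3 * Polynomial.X ^ 2) ^ 4) +
          Polynomial.C a₂ * ((Polynomial.X ^ 2 - 1) ^ 3 * (5 - 3 * Polynomial.X ^ 2) ^ 5)))) :
    q₀ = 0 ∧ q₁ = 0 ∧ q₂ = 0 := by
  have h1 := dvd_sub (h.mul_left 4398046511104) (Dvd.intro _ rfl :
    lineCubic ^ 2 ∣ lineCubic ^ 2 * (
    Polynomial.C q₀ *
      (1099511627776 * Polynomial.X ^ 18 + 4947802324992 * Polynomial.X ^ 17 +
        5703716569088 * Polynomial.X ^ 16 + 618475290624 * Polynomial.X ^ 15 +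
        17338782973952 * Polynomial.X ^ 14 + 63760936992768 * Polynomial.X ^ 13 +
        95483297005568 * Polynomial.X ^ 12 + 154567819919360 * Polynomial.X ^ 11 +
        364743269285888 * Polynomial.X ^ 10 + 759424683606016 * Polynomial.X ^ 9 +
        1447408167813120 * Polynomial.X ^ 8 + 2835506197954560 * Polynomial.X ^ 7 +
        5587356510650368 * Polynomial.X ^ 6 + 10884374873473024 * Polynomial.X ^ 5 +
        21102004364111872 * Polynomial.X ^ 4 + 40786634649059328 * Polynomial.X ^ 3 +
        78560746890178816 * Polynomial.X ^ 2 + 150844075305060480 * Polynomial.X +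
        288817455562845744) +
    Polynomial.C q₁ *
      (1099511627776 * Polynomial.X ^ 19 + 4947802324992 * Polynomial.X ^ 18 +
        5703716569088 * Polynomial.X ^ 17 + 618475290624 * Polynomial.X ^ 16 +
        17338782973952 * Polynomial.X ^ 15 + 63760936992768 * Polynomial.X ^ 14 +
        95483297005568 * Polynomial.X ^ 13 + 154567819919360 * Polynomial.X ^ 12 +
        364743269285888 * Polynomial.X ^ 11 + 759424683606016 * Polynomial.X ^ 10 +
        1447408167813120 * Polynomial.X ^ 9 + 2835506197954560 * Polynomial.X ^ 8 +
        5587356510650368 * Polynomial.X ^ 7 + 10884374873473024 * Polynomial.X ^ 6 +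
        21102004364111872 * Polynomial.X ^ 5 + 40786634649059328 * Polynomial.X ^ 4 +
        78560746890178816 * Polynomial.X ^ 3 + 150844075305060480 * Polynomial.X ^ 2 +
        288817455562845744 * Polynomial.X + 551561826501437136) +
    Polynomial.C q₂ *
      (1099511627776 * Polynomial.X ^ 20 + 4947802324992 * Polynomial.X ^ 19 +
        5703716569088 * Polynomial.X ^ 18 + 618475290624 * Polynomial.X ^ 17 +
        17338782973952 * Polynomial.X ^ 16 + 63760936992768 * Polynomial.X ^ 15 +
        95483297005568 * Polynomial.X ^ 14 + 154567819919360 * Polynomial.X ^ 13 +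
        364743269285888 * Polynomial.X ^ 12 + 759424683606016 * Polynomial.X ^ 11 +
        1447408167813120 * Polynomial.X ^ 10 + 2835506197954560 * Polynomial.X ^ 9 +
        5587356510650368 * Polynomial.X ^ 8 + 10884374873473024 * Polynomial.X ^ 7 +
        21102004364111872 * Polynomial.X ^ 6 + 40786634649059328 * Polynomial.X ^ 5 +
        78560746890178816 * Polynomial.X ^ 4 + 150844075305060480 * Polynomial.X ^ 3 +
        288817455562845744 * Polynomial.X ^ 2 + 551561826501437136 * Polynomial.X +
        1050832423020299349) +
    Polynomial.C a₀ *
      (-66795331387392 * Polynomial.X ^ 12 - 300578991243264 * Polynomial.X ^ 11 -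
        324235671109632 * Polynomial.X ^ 10 + 196211285950464 * Polynomial.X ^ 9 -
        210503863369728 * Polynomial.X ^ 8 - 2511130475888640 * Polynomial.X ^ 7 -
        4358664144027648 * Polynomial.X ^ 6 - 5867396564779008 * Polynomial.X ^ 5 -
        11972790668230656 * Polynomial.X ^ 4 - 25618259996835840 * Polynomial.X ^ 3 -
        49860331413176320 * Polynomial.X ^ 2 - 95965652248166400 * Polynomial.X -
        185699058489868288) +
    Polynomial.C a₁ *
      (89060441849856 * Polynomial.X ^ 13 + 200385994162176 * Polynomial.X ^ 12 -
        410049117683712 * Polynomial.X ^ 11 - 1011670956638208 * Polynomial.X ^ 10 +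
        1056085213446144 * Polynomial.X ^ 9 + 2697180406087680 * Polynomial.X ^ 8 -
        1092617936830464 * Polynomial.X ^ 7 - 3193486895480832 * Polynomial.X ^ 6 +
        1610514505400320 * Polynomial.X ^ 5 + 3981179036368896 * Polynomial.X ^ 4 +
        1771516959129600 * Polynomial.X ^ 3 + 2732920051859456 * Polynomial.X ^ 2 +
        7186334275928064 * Polynomial.X + 13144742055526400) +
    Polynomial.C a₂ *
      (-267181325549568 * Polynomial.X ^ 13 - 601157982486528 * Polynomial.X ^ 12 +
        1408268236750848 * Polynomial.X ^ 11 + 3435784858238976 * Polynomial.X ^ 10 -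
        3810232992006144 * Polynomial.X ^ 9 - 9714111143215104 * Polynomial.X ^ 8 +
        4748046885715968 * Polynomial.X ^ 7 + 13352251573665792 * Polynomial.X ^ 6 -
        5546586314637312 * Polynomial.X ^ 5 - 14558720012845056 * Polynomial.X ^ 4 -
        2808564665024512 * Polynomial.X ^ 3 - 2851584986578944 * Polynomial.X ^ 2 -
        15509982697160704 * Polynomial.X - 28621210893860864)))
  obtain ⟨he₀, he₁, he₂, he₃, he₄, he₅⟩ := coeff_eq_zero_of_lineCubic_sq_dvd
    (e₀ := -48810149990120930736 * q₀ - 93213948678742875984 * q₁ - 177590679490430589981 * q₂ +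
      31396884780134940672 * a₀ - 2185727279481241600 * a₁ + 4658314001548886016 * a₂)
    (e₁ := 4544366651980736256 * q₀ + 8552279966028531408 * q₁ + 16072623315368256312 * q₂ -
      3094506853006180352 * a₀ + 141567564865142784 * a₁ - 300443275752570880 * a₂)
    (e₂ := 65373293288730619872 * q₀ + 124784844829294031904 * q₁ + 237633748184453789490 * q₂ -
      42132633843204194304 * a₀ + 2897631613834657792 * a₁ - 6174825417428140032 * a₂)
    (e₃ := -16670698447902628864 * q₀ - 31701588175522316064 * q₁ - 60161661622278653520 * q₂ +
      10906533576611463168 * a₀ - 680652549864423424 * a₁ + 1449410409401810944 * a₂)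
    (e₄ := -22899132739778684208 * q₀ - 43697227946473048528 * q₁ - 83192376903516984165 * q₂ +
      14775627136367968256 * a₀ - 1008724329423585280 * a₁ + 2149451393272561664 * a₂)
    (e₅ := 8824989224022994176 * q₀ + 16813318768324789584 * q₁ + 31962706510988504600 * q₂ -
      5730957811749879808 * a₀ + 375711475539443712 * a₁ - 800387407698657280 * a₂)
    (by
      convert h1 using 1
      simp only [map_add, map_sub, map_neg, map_mul, map_ofNat, basePoly, lineCubic]
      ring)
  refine ⟨?_, ?_, ?_⟩
  · linear_combination
      (228194597088273820439849 / 7348522237454069708886787271688192) * he₀ +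
      (-692797230503261783551623 / 19596059299877519223698099391168512) * he₁ +
      (296150962015456383176579 / 7348522237454069708886787271688192) * he₂ +
      (-898725938930648234132163 / 19596059299877519223698099391168512) * he₃ +
      (128132969427364491490783 / 2449507412484689902962262423896064) * he₄ +
      (-1165636546353871079522159 / 19596059299877519223698099391168512) * he₅
  · linear_combination
      (838404447066658411522015 / 918565279681758713610848408961024) * he₀ +
      (-2581324801230351230588785 / 2449507412484689902962262423896064) * he₁ +
      (1143230031073832830125397 / 918565279681758713610848408961024) * he₂ +
      (-3491718681234361856336789 / 2449507412484689902962262423896064) * he₃ +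
      (519476039536538533674585 / 306188426560586237870282802987008) * he₄ +
      (-4700893829700224631407305 / 2449507412484689902962262423896064) * he₅
  · linear_combination
      (-198331250605633531252615 / 459282639840879356805424204480512) * he₀ +
      (610508040175677089034121 / 1224753706242344951481131211948032) * he₁ +
      (-270249915970586264819341 / 459282639840879356805424204480512) * he₂ +
      (825337176312697671084173 / 1224753706242344951481131211948032) * he₃ +
      (-122718219572612228398577 / 153094213280293118935141401493504) * he₄ +
      (1110586309933819093832225 / 1224753706242344951481131211948032) * he₅

lemma separable_pow_dvd {p F : Polynomial ℂ} {m : ℕ} (hp : p.Separable)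
    (h : ∀ r, p.IsRoot r → (Polynomial.X - Polynomial.C r) ^ m ∣ F) : p ^ m ∣ F := by
  classical
  by_cases hF : F = 0
  · simp [hF]
  refine ((IsAlgClosed.splits p).pow m).dvd_of_roots_le_roots (pow_ne_zero m hp.ne_zero) ?_
  rw [Polynomial.roots_pow, Multiset.le_iff_count]
  intro r
  rw [Multiset.count_nsmul]
  by_cases hr : p.IsRoot r
  · calc m * p.roots.count r ≤ m * 1 :=
          Nat.mul_le_mul_left m (Polynomial.count_roots_le_one hp r)
      _ = m := mul_one m
      _ ≤ F.rootMultiplicity r := (Polynomial.le_rootMultiplicity_iff hF).2 (h r hr)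
      _ = F.roots.count r := (Polynomial.count_roots F).symm
  · rw [Multiset.count_eq_zero_of_notMem fun hm => hr (Polynomial.isRoot_of_mem_roots hm)]
    simp

lemma natDegree_X_sq_sub_one : (Polynomial.X ^ 2 - 1 : Polynomial ℂ).natDegree = 2 := by
  compute_degree!

lemma separable_X_sq_sub_one : (Polynomial.X ^ 2 - 1 : Polynomial ℂ).Separable := by
  refine ⟨-1, Polynomial.C (1 / 2) * Polynomial.X, ?_⟩
  have h2 : (Polynomial.C (1 / 2) : Polynomial ℂ) * 2 = 1 := by
    rw [← Polynomial.C_ofNat, ← Polynomial.C_mul]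
    norm_num
  simp only [Polynomial.derivative_sub, Polynomial.derivative_X_pow, Polynomial.derivative_one,
    Nat.cast_ofNat, Polynomial.C_ofNat]
  linear_combination Polynomial.X ^ 2 * h2

lemma aeval_nodalCurve_h₂ : aeval nodalCurve h₂ = basePoly := by
  simp [h₂, nodalCurve, basePoly]
  ring

/-- Orders of vanishing at the base points and at the node of `h₁ = 0`, read on the
parametrisation. -/
lemma dvd_aeval_nodalCurve {f : MvPolynomial (Fin 3) ℂ} {m k : ℕ}
    (hbase : ∀ t, basePoly.IsRoot t → VanishesToOrder f (fun i => (nodalCurve i).eval t) m)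
    (hnode : VanishesToOrder f ![0, 1, 1] k) :
    basePoly ^ m * (Polynomial.X ^ 2 - 1) ^ k ∣ aeval nodalCurve f := by
  refine (isCoprime_basePoly_X_sq_sub_one.pow).mul_dvd
    (separable_pow_dvd separable_basePoly fun t ht => (hbase t ht).pow_dvd_aeval)
    (separable_pow_dvd separable_X_sq_sub_one fun t ht => ?_)
  refine VanishesToOrder.pow_dvd_aeval ?_
  have ht2 : t ^ 2 - 1 = 0 := by simpa using ht
  rwa [eval_nodalCurve, ht2, mul_zero, add_zero]

lemma exists_isRoot_basePoly {f : MvPolynomial (Fin 3) ℂ} {m : ℕ}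
    (hbase : ∀ p : Fin 3 → ℂ, p ≠ 0 → eval p h₁ = 0 → eval p h₂ = 0 →
      (∀ c : ℂ, p ≠ c • ![0, 1, 0]) → VanishesToOrder f p m)
    (t : ℂ) (ht : basePoly.IsRoot t) :
    VanishesToOrder f (fun i => (nodalCurve i).eval t) m := by
  have h2 : (nodalCurve 2).eval t = 1 := by simp [nodalCurve]
  refine hbase _ (fun h => ?_) ?_ ?_ (fun c h => ?_)
  · have := congrFun h 2
    simp [h2] at this
  · rw [← eval_aeval_polynomial, aeval_nodalCurve_h₁, Polynomial.eval_zero]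
  · rwa [← eval_aeval_polynomial, aeval_nodalCurve_h₂]
  · have := congrFun h 2
    simp [h2] at this

lemma aeval_nodalCurve_pderiv_h₁ : aeval nodalCurve (pderiv 0 h₁) =
    -((Polynomial.X ^ 2 - 1) * (3 * Polynomial.X ^ 2 - 1)) := by
  simp [h₁, nodalCurve]
  ring

lemma aeval_nodalCurve_pderiv_h₁_mul (g : MvPolynomial (Fin 3) ℂ) :
    aeval nodalCurve (pderiv 0 (h₁ * g)) =
      -((Polynomial.X ^ 2 - 1) * (3 * Polynomial.X ^ 2 - 1)) * aeval nodalCurve g := by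
  rw [pderiv_mul, map_add, map_mul, map_mul, aeval_nodalCurve_h₁, aeval_nodalCurve_pderiv_h₁]
  ring

/-- Dividing by `h₁` lowers the orders along the curve by one at the smooth base points and by
two at the node. -/
lemma dvd_of_dvd_mul_pderiv {F : Polynomial ℂ} {m k : ℕ}
    (h : basePoly ^ m * (Polynomial.X ^ 2 - 1) ^ (k + 1) ∣
      -((Polynomial.X ^ 2 - 1) * (3 * Polynomial.X ^ 2 - 1)) * F) :
    basePoly ^ m * (Polynomial.X ^ 2 - 1) ^ k ∣ F := by
  have hcop : IsCoprime (basePoly ^ m * (Polynomial.X ^ 2 - 1) ^ k)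
      (3 * Polynomial.X ^ 2 - 1 : Polynomial ℂ) :=
    isCoprime_basePoly_three_mul_X_sq_sub_one.pow_left.mul_left
      isCoprime_X_sq_sub_one_three_mul_X_sq_sub_one.pow_left
  refine hcop.dvd_of_dvd_mul_left ?_
  rw [neg_mul, dvd_neg, mul_assoc, pow_succ', mul_left_comm] at h
  exact (mul_dvd_mul_iff_left separable_X_sq_sub_one.ne_zero).1 h

/-- The linear change of coordinates taking `(1, 0, 0)` to `(4, 9, 6)` and fixing `(0, 0, 1)`. -/
noncomputable def frame : Fin 3 → MvPolynomial (Fin 3) ℂ :=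
  ![4 * X 0, 9 * X 0 + X 1, 6 * X 0 + X 2]

/-- The parametrisation `nodalCurve` in the coordinates given by `frame`. -/
noncomputable def framedCurve : Fin 3 → Polynomial ℂ :=
  ![Polynomial.C 4⁻¹ * (Polynomial.X ^ 2 - 1), Polynomial.C 4⁻¹ * lineCubic,
    Polynomial.C 2⁻¹ * (5 - 3 * Polynomial.X ^ 2)]

lemma isHomogeneous_aeval_frame {f : MvPolynomial (Fin 3) ℂ} {n : ℕ} (hf : f.IsHomogeneous n) :
    (aeval frame f).IsHomogeneous n := by
  have hX (i : Fin 3) : (X i : MvPolynomial (Fin 3) ℂ).IsHomogeneous 1 := isHomogeneous_X _ _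
  have hC (c : ℂ) (i : Fin 3) : (C c * X i : MvPolynomial (Fin 3) ℂ).IsHomogeneous 1 :=
    isHomogeneous_C_mul_X c i
  have := hf.aeval frame (n := 1) (fun i => by
    fin_cases i
    · exact hC 4 0
    · exact (hC 9 0).add (hX 1)
    · exact (hC 6 0).add (hX 2))
  simpa using this

lemma aeval_framedCurve (f : MvPolynomial (Fin 3) ℂ) :
    aeval framedCurve (aeval frame f) = aeval nodalCurve f := by
  have h4 : (Polynomial.C 4⁻¹ : Polynomial ℂ) * 4 = 1 := by
    rw [← Polynomial.C_ofNat, ← Polynomial.C_mul]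
    norm_num
  have h2 : (Polynomial.C 2⁻¹ : Polynomial ℂ) = Polynomial.C 4⁻¹ * 2 := by
    rw [← Polynomial.C_ofNat, ← Polynomial.C_mul]
    norm_num
  rw [comp_aeval_apply]
  congr 2
  ext1 i
  fin_cases i
  · simp [frame, framedCurve, nodalCurve]
    linear_combination (Polynomial.X ^ 2 - 1) * h4
  · simp [frame, framedCurve, nodalCurve, lineCubic]
    linear_combination (1 + Polynomial.X * (Polynomial.X ^ 2 - 1)) * h4
  · simp [frame, framedCurve, nodalCurve]
    linear_combination h4 + (5 - 3 * Polynomial.X ^ 2) * h2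

lemma eq_zero_of_aeval_frame_eq_zero {f : MvPolynomial (Fin 3) ℂ} (h : aeval frame f = 0) :
    f = 0 := by
  have h4 : (C 4⁻¹ : MvPolynomial (Fin 3) ℂ) * 4 = 1 := by
    rw [← map_ofNat C 4, ← C_mul]
    norm_num
  have hinv : aeval ![C 4⁻¹ * X 0, X 1 - 9 * (C 4⁻¹ * X 0), X 2 - 6 * (C 4⁻¹ * X 0)]
      (aeval frame f) = f := by
    rw [comp_aeval_apply]
    conv_rhs => rw [← aeval_X_left_apply f]
    congr 2
    ext1 i
    fin_cases i
    · simp [frame, map_ofNat]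
      linear_combination X 0 * h4
    · simp [frame, map_ofNat]
    · simp [frame, map_ofNat]
  rw [← hinv, h, map_zero]

lemma coeff_aeval_frame_eq_zero {f : MvPolynomial (Fin 3) ℂ} {n a b : ℕ} (hf : f.IsHomogeneous n)
    (ha : VanishesToOrder f ![4, 9, 6] a) (hb : VanishesToOrder f ![0, 0, 1] b)
    {d : Fin 3 →₀ ℕ} (hd : n < d 0 + a ∨ n < d 2 + b) : coeff d (aeval frame f) = 0 := by
  rcases hd with hd | hd
  · refine VanishesToOrder.coeff_eq_zero (isHomogeneous_aeval_frame hf) (.comp (m := a) ?_) hd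
    convert ha using 1
    ext i
    fin_cases i <;> simp [frame]
  · refine VanishesToOrder.coeff_eq_zero (isHomogeneous_aeval_frame hf) (.comp (m := b) ?_) hd
    convert hb using 1
    ext i
    fin_cases i <;> simp [frame]

lemma pow_dvd_aeval_sub_sum {φ : MvPolynomial (Fin 3) ℂ} {δ : Fin 3 → Polynomial ℂ} {m : ℕ}
    (j : Fin 3) (S : Finset (Fin 3 →₀ ℕ)) (h : ∀ d ∉ S, coeff d φ ≠ 0 → m ≤ d j) :
    δ j ^ m ∣ aeval δ φ - ∑ d ∈ S, Polynomial.C (coeff d φ) * ∏ i, δ i ^ d i := by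
  classical
  have hsum : aeval δ φ =
      ∑ d ∈ φ.support ∪ S, Polynomial.C (coeff d φ) * ∏ i, δ i ^ d i := by
    rw [aeval_def, eval₂_eq', Polynomial.algebraMap_eq]
    refine Finset.sum_subset Finset.subset_union_left fun d _ hd => ?_
    rw [notMem_support_iff.1 hd, Polynomial.C_0, zero_mul]
  rw [hsum, ← Finset.sum_sdiff (Finset.subset_union_right : S ⊆ φ.support ∪ S),
    add_sub_cancel_right]
  refine Finset.dvd_sum fun d hd => Dvd.dvd.mul_left ?_ _
  rw [Finset.mem_sdiff, Finset.mem_union] at hd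
  have hdS := hd.1.resolve_right hd.2
  exact (pow_dvd_pow _ (h d hd.2 (mem_support_iff.1 hdS))).trans
    (Finset.dvd_prod_of_mem (fun i => δ i ^ d i) (Finset.mem_univ j))

lemma eval_h₁_of_four_nine_six : eval ![4, 9, 6] h₁ ≠ 0 := by
  simp [h₁]
  norm_num

lemma eval_h₁_of_zero_zero_one : eval ![0, 0, 1] h₁ ≠ 0 := by
  simp [h₁]

lemma lineCubic_dvd_framedCurve_one : lineCubic ∣ framedCurve 1 :=
  Dvd.intro_left _ rfl

/-- The coefficients of a nonic with a quintuple point at `(4, 9, 6)` and a quadruple point at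
`(0, 0, 1)`, to second order along the line joining the two points. -/
lemma exists_lineCubic_sq_dvd {g : MvPolynomial (Fin 3) ℂ} (hg : g.IsHomogeneous 9)
    (h₀ : VanishesToOrder g ![4, 9, 6] 5) (h₂ : VanishesToOrder g ![0, 0, 1] 4) :
    ∃ a₀ a₁ a₂ : ℂ, lineCubic ^ 2 ∣ aeval nodalCurve g +
      (Polynomial.C a₀ * ((Polynomial.X ^ 2 - 1) ^ 4 * (5 - 3 * Polynomial.X ^ 2) ^ 5) +
        lineCubic * (Polynomial.C a₁ * ((Polynomial.X ^ 2 - 1) ^ 4 *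
            (5 - 3 * Polynomial.X ^ 2) ^ 4) +
          Polynomial.C a₂ * ((Polynomial.X ^ 2 - 1) ^ 3 * (5 - 3 * Polynomial.X ^ 2) ^ 5))) := by
  let e (v : Fin 3 → ℕ) : Fin 3 →₀ ℕ := Finsupp.equivFunOnFinite.symm v
  have hne : e ![4, 0, 5] ∉ ({e ![4, 1, 4], e ![3, 1, 5]} : Finset (Fin 3 →₀ ℕ)) := by
    simp [e]
  have hne' : e ![4, 1, 4] ∉ ({e ![3, 1, 5]} : Finset (Fin 3 →₀ ℕ)) := by
    simp [e]
  set φ := aeval frame g with hφ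
  have hdvd := pow_dvd_aeval_sub_sum (φ := φ) (δ := framedCurve) (m := 2) 1
    {e ![4, 0, 5], e ![4, 1, 4], e ![3, 1, 5]} (by
      intro d hd hc
      by_contra! hlt
      have hdeg : d 0 + d 1 + d 2 = 9 := by
        by_contra hne
        refine hc ((isHomogeneous_aeval_frame hg).coeff_eq_zero ?_)
        rwa [Finsupp.degree_eq_sum, Fin.sum_univ_three]
      have hbd : ¬(9 < d 0 + 5 ∨ 9 < d 2 + 4) := fun h =>
        hc (coeff_aeval_frame_eq_zero hg h₀ h₂ h)
      have hd' (v : Fin 3 → ℕ) (h0 : d 0 = v 0) (h1 : d 1 = v 1) (h2 : d 2 = v 2) : d = e v := by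
        ext i
        fin_cases i
        exacts [h0, h1, h2]
      apply hd
      simp only [Finset.mem_insert, Finset.mem_singleton]
      rcases (by omega : (d 0 = 4 ∧ d 1 = 0 ∧ d 2 = 5) ∨ (d 0 = 4 ∧ d 1 = 1 ∧ d 2 = 4) ∨
        (d 0 = 3 ∧ d 1 = 1 ∧ d 2 = 5)) with h | h | h
      · exact .inl (hd' _ h.1 h.2.1 h.2.2)
      · exact .inr (.inl (hd' _ h.1 h.2.1 h.2.2))
      · exact .inr (.inr (hd' _ h.1 h.2.1 h.2.2)))
  refine ⟨-(coeff (e ![4, 0, 5]) φ * (4⁻¹ ^ 4 * 2⁻¹ ^ 5)),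
    -(coeff (e ![4, 1, 4]) φ * (4⁻¹ ^ 5 * 2⁻¹ ^ 4)),
    -(coeff (e ![3, 1, 5]) φ * (4⁻¹ ^ 4 * 2⁻¹ ^ 5)), ?_⟩
  refine (pow_dvd_pow_of_dvd lineCubic_dvd_framedCurve_one 2).trans ?_
  convert hdvd using 1
  rw [Finset.sum_insert hne, Finset.sum_insert hne', Finset.sum_singleton, hφ, aeval_framedCurve]
  simp only [e, Finsupp.equivFunOnFinite_symm_apply_apply, Fin.prod_univ_three, framedCurve,
    Matrix.cons_val, map_neg, map_mul, map_pow]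
  ring

/-- A nonic singular at the eight base points and passing through `(0, 1, 0)`, with the
multiplicities `4` and `5`, `4` at the node and the two further points, contains the nodal cubic. -/
lemma aeval_nodalCurve_eq_zero {g : MvPolynomial (Fin 3) ℂ} (hg : g.IsHomogeneous 9)
    (hdvd : basePoly ^ 2 * (Polynomial.X ^ 2 - 1) ^ 4 ∣ aeval nodalCurve g)
    (hinf : eval ![0, 1, 0] g = 0)
    (h₀ : VanishesToOrder g ![4, 9, 6] 5) (h₂ : VanishesToOrder g ![0, 0, 1] 4) :
    aeval nodalCurve g = 0 := by
  obtain ⟨hdeg, hcoeff⟩ := hg.natDegree_aeval_le_and_coeff natDegree_nodalCurve_le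
  rw [coeff_nodalCurve, hinf] at hcoeff
  obtain ⟨q, hq⟩ := hdvd
  have hN : (basePoly ^ 2 * (Polynomial.X ^ 2 - 1) ^ 4).natDegree = 24 := by
    rw [Polynomial.natDegree_mul (pow_ne_zero _ separable_basePoly.ne_zero)
      (pow_ne_zero _ separable_X_sq_sub_one.ne_zero), Polynomial.natDegree_pow,
      Polynomial.natDegree_pow, natDegree_basePoly, natDegree_X_sq_sub_one]
  by_cases h0 : aeval nodalCurve g = 0
  · exact h0
  have hlt : (aeval nodalCurve g).natDegree < 27 := by
    refine lt_of_le_of_ne hdeg fun h => ?_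
    rw [show 9 * 3 = (aeval nodalCurve g).natDegree from h.symm, Polynomial.coeff_natDegree,
      Polynomial.leadingCoeff_eq_zero] at hcoeff
    exact h0 hcoeff
  have hq0 : q ≠ 0 := by
    rintro rfl
    exact h0 (by rw [hq, mul_zero])
  have hqdeg : q.natDegree ≤ 2 := by
    have hN0 : basePoly ^ 2 * (Polynomial.X ^ 2 - 1) ^ 4 ≠ 0 := by
      intro h
      exact h0 (by rw [hq, h, zero_mul])
    rw [hq, Polynomial.natDegree_mul hN0 hq0, hN] at hlt
    omega
  obtain ⟨a₀, a₁, a₂, ha⟩ := exists_lineCubic_sq_dvd hg h₀ h₂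
  have hqsum : q = Polynomial.C (q.coeff 0) + Polynomial.C (q.coeff 1) * Polynomial.X +
      Polynomial.C (q.coeff 2) * Polynomial.X ^ 2 := by
    conv_lhs => rw [q.as_sum_range_C_mul_X_pow' (n := 3) (by omega)]
    simp [Finset.sum_range_succ]
  rw [hq, hqsum] at ha
  obtain ⟨hc0, hq1, hq2⟩ := eq_zero_of_lineCubic_sq_dvd ha
  rw [hc0, hq1, hq2] at hqsum
  exact absurd (by simpa using hqsum) hq0

/-- There is no sextic through the eight base points with multiplicities `2`, `5` and `4` at the
node and the two further points. -/
lemma sextic_eq_zero {k : MvPolynomial (Fin 3) ℂ} (hk : k.IsHomogeneous 6)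
    (hdvd : basePoly ^ 1 * (Polynomial.X ^ 2 - 1) ^ 2 ∣ aeval nodalCurve k)
    (h₀ : VanishesToOrder k ![4, 9, 6] 5) (h₂ : VanishesToOrder k ![0, 0, 1] 4) : k = 0 := by
  have hline : lineCubic ^ 3 ∣ aeval nodalCurve k := by
    have := pow_dvd_aeval_sub_sum (φ := aeval frame k) (δ := framedCurve) (m := 3) 1 ∅ (by
      intro d _ hc
      have hdeg : d 0 + d 1 + d 2 = 6 := by
        by_contra hne
        refine hc ((isHomogeneous_aeval_frame hk).coeff_eq_zero ?_)
        rwa [Finsupp.degree_eq_sum, Fin.sum_univ_three]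
      have hbd : ¬(6 < d 0 + 5 ∨ 6 < d 2 + 4) := fun h =>
        hc (coeff_aeval_frame_eq_zero hk h₀ h₂ h)
      omega)
    rw [Finset.sum_empty, sub_zero, aeval_framedCurve] at this
    exact (pow_dvd_pow_of_dvd lineCubic_dvd_framedCurve_one 3).trans this
  have hcop : IsCoprime (basePoly ^ 1 * (Polynomial.X ^ 2 - 1) ^ 2) (lineCubic ^ 3) :=
    isCoprime_basePoly_lineCubic.pow.mul_left isCoprime_X_sq_sub_one_lineCubic.pow
  have hK : aeval nodalCurve k = 0 := by
    refine Polynomial.eq_zero_of_dvd_of_natDegree_lt (hcop.mul_dvd hdvd hline) ?_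
    have hlc0 : lineCubic ≠ 0 := by
      intro h
      have := natDegree_lineCubic
      simp [h] at this
    rw [Polynomial.natDegree_mul (mul_ne_zero (pow_ne_zero _ separable_basePoly.ne_zero)
      (pow_ne_zero _ separable_X_sq_sub_one.ne_zero)) (pow_ne_zero _ hlc0),
      Polynomial.natDegree_mul (pow_ne_zero _ separable_basePoly.ne_zero)
      (pow_ne_zero _ separable_X_sq_sub_one.ne_zero), Polynomial.natDegree_pow,
      Polynomial.natDegree_pow, Polynomial.natDegree_pow, natDegree_basePoly,
      natDegree_X_sq_sub_one, natDegree_lineCubic]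
    exact (hk.natDegree_aeval_le_and_coeff natDegree_nodalCurve_le).1.trans_lt (by norm_num)
  obtain ⟨c, hc, rfl⟩ := exists_eq_h₁_mul_of_aeval_eq_zero (n := 3) hk hK
  have hc0 : c = 0 := by
    refine eq_zero_of_aeval_frame_eq_zero (MvPolynomial.ext _ _ fun d => ?_)
    rw [coeff_zero]
    exact coeff_aeval_frame_eq_zero hc (h₀.of_mul_left eval_h₁_of_four_nine_six)
      (VanishesToOrder.zero_right _ _) (.inl (by omega))
  rw [hc0, mul_zero]

/-- Every homogeneous polynomial of degree 12 vanishing to order `≥ 3` at the eight base points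
of the pencil `⟨h₁, h₂⟩` other than `(0,1,0)`, to order `≥ 2` at `(0,1,0)`, to order `≥ 5`
at `(4,9,6)`, to order `≥ 6` at `(0,1,1)` and to order `≥ 4` at `(0,0,1)` is zero (the
computation `h⁰₁₂,₉ = 0`). -/
theorem degree_twelve_vanishing_h0_12_9
    (f : MvPolynomial (Fin 3) ℂ)
    (hf : f.IsHomogeneous 12)
    (hbase : ∀ p : Fin 3 → ℂ, p ≠ 0 → MvPolynomial.eval p h₁ = 0 →
      MvPolynomial.eval p h₂ = 0 → (∀ c : ℂ, p ≠ c • ![0, 1, 0]) →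
      VanishesToOrder f p 3)
    (hE9 : VanishesToOrder f ![0, 1, 0] 2)
    (hE0 : VanishesToOrder f ![4, 9, 6] 5)
    (hB1 : VanishesToOrder f ![0, 1, 1] 6)
    (hB2 : VanishesToOrder f ![0, 0, 1] 4) :
    f = 0 := by
  have hbaseR := exists_isRoot_basePoly hbase
  have hF : aeval nodalCurve f = 0 := by
    obtain ⟨hdeg, hcoeff⟩ := hf.natDegree_aeval_le_and_coeff natDegree_nodalCurve_le
    rw [coeff_nodalCurve, hE9.eval_eq_zero (by norm_num)] at hcoeff
    by_contra h0
    have hle := Polynomial.natDegree_le_of_dvd (dvd_aeval_nodalCurve hbaseR hB1) h0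
    rw [Polynomial.natDegree_mul (pow_ne_zero _ separable_basePoly.ne_zero)
      (pow_ne_zero _ separable_X_sq_sub_one.ne_zero), Polynomial.natDegree_pow,
      Polynomial.natDegree_pow, natDegree_basePoly, natDegree_X_sq_sub_one] at hle
    rw [← le_antisymm hdeg hle, Polynomial.coeff_natDegree,
      Polynomial.leadingCoeff_eq_zero] at hcoeff
    exact h0 hcoeff
  obtain ⟨g, hg, rfl⟩ := exists_eq_h₁_mul_of_aeval_eq_zero (n := 9) hf hF
  have hg0 := hE0.of_mul_left eval_h₁_of_four_nine_six
  have hg2 := hB2.of_mul_left eval_h₁_of_zero_zero_one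
  have hginf : eval ![0, 1, 0] g = 0 := by
    have := (hE9.pderiv 2).eval_eq_zero (by norm_num)
    simpa [pderiv_mul, h₁, pderiv_X_of_ne] using this
  have hgdvd := dvd_aeval_nodalCurve (fun t ht => (hbaseR t ht).pderiv 0) (hB1.pderiv 0)
  rw [aeval_nodalCurve_pderiv_h₁_mul] at hgdvd
  have hG := aeval_nodalCurve_eq_zero hg (dvd_of_dvd_mul_pderiv hgdvd) hginf hg0 hg2
  obtain ⟨k, hk, rfl⟩ := exists_eq_h₁_mul_of_aeval_eq_zero (n := 6) hg hG
  have hkdvd := dvd_aeval_nodalCurve (fun t ht => ((hbaseR t ht).pderiv 0).pderiv 0)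
    ((hB1.pderiv 0).pderiv 0)
  have hkk : aeval nodalCurve (pderiv 0 (pderiv 0 (h₁ * (h₁ * k)))) =
      -((Polynomial.X ^ 2 - 1) * (3 * Polynomial.X ^ 2 - 1)) *
        (-((Polynomial.X ^ 2 - 1) * (3 * Polynomial.X ^ 2 - 1)) * aeval nodalCurve k) * 2 := by
    rw [pderiv_mul, map_add, map_add, mul_comm (pderiv 0 h₁), mul_assoc h₁ k,
      aeval_nodalCurve_pderiv_h₁_mul, aeval_nodalCurve_pderiv_h₁_mul, map_mul,
      aeval_nodalCurve_pderiv_h₁, aeval_nodalCurve_pderiv_h₁_mul]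
    ring
  have h2 : IsUnit (2 : Polynomial ℂ) := by
    rw [← Polynomial.C_ofNat, Polynomial.isUnit_C]
    exact isUnit_iff_ne_zero.2 two_ne_zero
  rw [hkk, h2.dvd_mul_right] at hkdvd
  rw [sextic_eq_zero hk (dvd_of_dvd_mul_pderiv (dvd_of_dvd_mul_pderiv hkdvd))
    (hg0.of_mul_left eval_h₁_of_four_nine_six) (hg2.of_mul_left eval_h₁_of_zero_zero_one),
    mul_zero, mul_zero]
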